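/- arXiv:2108.06777 — 2 statements merged into one kernel-verified Lean document; each statement's English description precedes it below -/
import Mathlib

section
/- Let d ≥ 1 be an integer and let α, β ∈ ℝ satisfy α + β > d, α < d, and β ≠ d, and set λ = max(d − β, 0). Then there exists a constant C > 0 such that for every n ∈ ℤ^d the series ∑_{n₁ ∈ ℤ^d} ⟨n₁⟩^(−α) ⟨n − n₁⟩^(−β) converges and is bounded by C ⟨n⟩^(−α+λ). -/
open scoped BigOperators

/-- The Japanese bracket `⟨m⟩ = (1 + |m|²)^{1/2}` of a lattice point `m ∈ ℤ^d`,
where `|m|` is the Euclidean norm. -/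
noncomputable def japaneseBracket {d : ℕ} (m : Fin d → ℤ) : ℝ :=
  (1 + ∑ i, ((m i : ℝ)) ^ 2) ^ ((1 : ℝ) / 2)

open scoped ENNReal

lemma jb_sq {d : ℕ} (m : Fin d → ℤ) :
    japaneseBracket m ^ 2 = 1 + ∑ i, ((m i : ℝ)) ^ 2 := by
  unfold japaneseBracket
  rw [← Real.sqrt_eq_rpow, Real.sq_sqrt]
  positivity

lemma jb_nonneg {d : ℕ} (m : Fin d → ℤ) : 0 ≤ japaneseBracket m := by
  unfold japaneseBracket; positivity

lemma jb_one_le {d : ℕ} (m : Fin d → ℤ) : 1 ≤ japaneseBracket m := by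
  have h := jb_sq m
  have h2 : 0 ≤ ∑ i, ((m i : ℝ)) ^ 2 := by positivity
  nlinarith [jb_nonneg m]

lemma jb_pos {d : ℕ} (m : Fin d → ℤ) : 0 < japaneseBracket m :=
  lt_of_lt_of_le one_pos (jb_one_le m)

lemma jb_coord {d : ℕ} (m : Fin d → ℤ) (i : Fin d) : |(m i : ℝ)| ≤ japaneseBracket m := by
  apply abs_le_of_sq_le_sq _ (jb_nonneg m)
  rw [jb_sq]
  have := Finset.single_le_sum (f := fun i => ((m i : ℝ)) ^ 2) (fun i _ => sq_nonneg _)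
    (Finset.mem_univ i)
  linarith

lemma jb_neg {d : ℕ} (m : Fin d → ℤ) : japaneseBracket (-m) = japaneseBracket m := by
  simp [japaneseBracket]

lemma jb_add {d : ℕ} (a b : Fin d → ℤ) :
    japaneseBracket (a + b) ≤ japaneseBracket a + japaneseBracket b := by
  have ha := jb_sq a
  have hb := jb_sq b
  have hab := jb_sq (a + b)
  have hA := jb_nonneg a
  have hB := jb_nonneg b
  have cs := Finset.sum_mul_sq_le_sq_mul_sq Finset.univ (fun i => (a i : ℝ)) (fun i => (b i : ℝ))
  have h1 : ∑ i, (((a + b) i : ℤ) : ℝ) ^ 2 =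
      ∑ i, (a i : ℝ) ^ 2 + ∑ i, (b i : ℝ) ^ 2 + 2 * ∑ i, (a i : ℝ) * (b i : ℝ) := by
    rw [Finset.mul_sum, ← Finset.sum_add_distrib, ← Finset.sum_add_distrib]
    refine Finset.sum_congr rfl fun i _ => ?_
    simp only [Pi.add_apply]; push_cast; ring
  have h0a : 0 ≤ ∑ i, (a i : ℝ) ^ 2 := by positivity
  have h0b : 0 ≤ ∑ i, (b i : ℝ) ^ 2 := by positivity
  have h2 : |∑ i, (a i : ℝ) * (b i : ℝ)| ≤ japaneseBracket a * japaneseBracket b := by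
    apply abs_le_of_sq_le_sq _ (by positivity)
    rw [mul_pow, ha, hb]
    nlinarith
  have h3 := le_of_abs_le h2
  refine (sq_le_sq₀ (jb_nonneg _) (by positivity)).1 ?_
  nlinarith

lemma rpow_comp (s : ℝ) {x y : ℝ} (hy : 0 < y) (h1 : y / 4 ≤ x) (h2 : x ≤ 4 * y) :
    x ^ s ≤ 4 ^ |s| * y ^ s := by
  have hx : 0 < x := by linarith
  rcases le_total 0 s with hs | hs
  · rw [abs_of_nonneg hs, ← Real.mul_rpow (by norm_num) hy.le]
    exact Real.rpow_le_rpow hx.le h2 hs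
  · rw [abs_of_nonpos hs]
    have : (4:ℝ) ^ (-s) * y ^ s = (y / 4) ^ s := by
      rw [Real.div_rpow hy.le (by norm_num), Real.rpow_neg (by norm_num)]
      field_simp
    rw [this]
    exact Real.rpow_le_rpow_of_nonpos (by linarith) h1 hs

lemma shell_bound (d : ℕ) (γ : ℝ) : ∃ C : ℝ, 0 < C ∧ ∀ ρ : ℝ, 0 < ρ →
    ∑' m : Fin d → ℤ, Set.indicator {m | ρ / 2 ≤ japaneseBracket m ∧ japaneseBracket m ≤ 2 * ρ}
      (fun m => ENNReal.ofReal (japaneseBracket m ^ (-γ))) m ≤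
    ENNReal.ofReal (C * ρ ^ ((d : ℝ) - γ)) := by
  refine ⟨4 ^ |(-γ)| * 6 ^ d, by positivity, fun ρ hρ => ?_⟩
  by_cases hsmall : 2 * ρ < 1
  · have : ∀ m : Fin d → ℤ, Set.indicator
      {m | ρ / 2 ≤ japaneseBracket m ∧ japaneseBracket m ≤ 2 * ρ}
      (fun m => ENNReal.ofReal (japaneseBracket m ^ (-γ))) m = 0 := by
      intro m
      apply Set.indicator_of_notMem
      rintro ⟨-, h⟩
      linarith [jb_one_le m]
    simp [this]
  push Not at hsmall
  set F : Finset (Fin d → ℤ) := Finset.Icc (fun _ => -⌊2 * ρ⌋) (fun _ => ⌊2 * ρ⌋) with hF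
  have hmem : ∀ m : Fin d → ℤ, japaneseBracket m ≤ 2 * ρ → m ∈ F := by
    intro m hm
    rw [hF, Finset.mem_Icc]
    constructor
    · intro i
      have := (abs_le.1 ((jb_coord m i).trans hm)).1
      have h3 : -m i ≤ ⌊2 * ρ⌋ := Int.le_floor.2 (by push_cast; linarith)
      simp only
      linarith
    · intro i
      have := (abs_le.1 ((jb_coord m i).trans hm)).2
      exact Int.le_floor.2 this
  have hcard : (F.card : ℝ) ≤ (6 * ρ) ^ d := by
    have hfl : 0 ≤ ⌊2 * ρ⌋ := Int.floor_nonneg.2 (by linarith)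
    rw [hF, Pi.card_Icc]
    simp only [Int.card_Icc, Finset.prod_const, Finset.card_univ, Fintype.card_fin]
    push_cast
    apply pow_le_pow_left₀ (by positivity)
    have h5 : (((⌊2 * ρ⌋ + 1 - -⌊2 * ρ⌋).toNat : ℤ) : ℝ) = 2 * (⌊2 * ρ⌋ : ℝ) + 1 := by
      rw [Int.toNat_of_nonneg (by linarith)]; push_cast; ring
    have h6 := Int.floor_le (2 * ρ)
    rw [Int.cast_natCast] at h5
    rw [h5]; linarith
  rw [tsum_eq_sum (s := F)]
  · calc _ ≤ ∑ m ∈ F, ENNReal.ofReal (4 ^ |(-γ)| * ρ ^ (-γ)) := by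
          refine Finset.sum_le_sum fun m _ => ?_
          apply Set.indicator_le'  _ _ m
          · rintro m ⟨h1, h2⟩
            exact ENNReal.ofReal_le_ofReal (rpow_comp _ hρ (by linarith) (by linarith))
          · intro m _; positivity
      _ = ENNReal.ofReal (F.card * (4 ^ |(-γ)| * ρ ^ (-γ))) := by
          rw [Finset.sum_const, nsmul_eq_mul,
            ENNReal.ofReal_mul (p := (F.card : ℝ)) (by positivity), ENNReal.ofReal_natCast]
      _ ≤ _ := by
          apply ENNReal.ofReal_le_ofReal
          have : ρ ^ ((d : ℝ) - γ) = ρ ^ d * ρ ^ (-γ) := by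
            rw [sub_eq_add_neg, Real.rpow_add hρ, Real.rpow_natCast]
          rw [this]
          calc _ ≤ (6 * ρ) ^ d * (4 ^ |(-γ)| * ρ ^ (-γ)) := by gcongr
            _ = _ := by rw [mul_pow]; ring
  · intro m hm
    apply Set.indicator_of_notMem
    rintro ⟨-, h⟩
    exact hm (hmem m h)

lemma dyadic_bound (d : ℕ) (γ θ : ℝ) (hθ : 0 < θ) (hθ1 : θ ^ ((d : ℝ) - γ) < 1) :
    ∃ C : ℝ, 0 < C ∧ ∀ R : ℝ, 0 < R → ∀ S : Set (Fin d → ℤ),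
    (∀ m ∈ S, ∃ j : ℕ, (θ ^ j * R) / 2 ≤ japaneseBracket m ∧
      japaneseBracket m ≤ 2 * (θ ^ j * R)) →
    ∑' m : Fin d → ℤ, Set.indicator S
      (fun m => ENNReal.ofReal (japaneseBracket m ^ (-γ))) m ≤
    ENNReal.ofReal (C * R ^ ((d : ℝ) - γ)) := by
  obtain ⟨C, hC, h⟩ := shell_bound d γ
  set q := θ ^ ((d : ℝ) - γ) with hq
  have hq0 : 0 < q := by positivity
  refine ⟨C * (1 - q)⁻¹, mul_pos hC (inv_pos.2 (by linarith)), fun R hR S hS => ?_⟩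
  calc _ ≤ ∑' m : Fin d → ℤ, ∑' j : ℕ, Set.indicator
        {m | (θ ^ j * R) / 2 ≤ japaneseBracket m ∧ japaneseBracket m ≤ 2 * (θ ^ j * R)}
        (fun m => ENNReal.ofReal (japaneseBracket m ^ (-γ))) m := by
        refine ENNReal.tsum_le_tsum fun m => ?_
        by_cases hm : m ∈ S
        · obtain ⟨j, hj⟩ := hS m hm
          refine le_trans ?_ (ENNReal.le_tsum j)
          rw [Set.indicator_of_mem hm, Set.indicator_of_mem]
          exact hj
        · rw [Set.indicator_of_notMem hm]; positivity
    _ = ∑' j : ℕ, ∑' m : Fin d → ℤ, Set.indicator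
        {m | (θ ^ j * R) / 2 ≤ japaneseBracket m ∧ japaneseBracket m ≤ 2 * (θ ^ j * R)}
        (fun m => ENNReal.ofReal (japaneseBracket m ^ (-γ))) m := ENNReal.tsum_comm
    _ ≤ ∑' j : ℕ, ENNReal.ofReal (C * R ^ ((d : ℝ) - γ) * q ^ j) := by
        refine ENNReal.tsum_le_tsum fun j => ?_
        refine (h (θ ^ j * R) (by positivity)).trans (le_of_eq ?_)
        congr 1
        rw [Real.mul_rpow (by positivity) hR.le, hq, ← Real.rpow_natCast, ← Real.rpow_natCast,
          ← Real.rpow_mul hθ.le, ← Real.rpow_mul hθ.le, mul_comm (j : ℝ)]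
        ring
    _ = _ := by
        rw [← ENNReal.ofReal_tsum_of_nonneg (fun j => by positivity)
          ((summable_geometric_of_lt_one hq0.le hθ1).mul_left _), tsum_mul_left,
          tsum_geometric_of_lt_one hq0.le hθ1]
        congr 1; ring

lemma inner_bound (d : ℕ) (γ : ℝ) (hγ : γ < d) :
    ∃ C : ℝ, 0 < C ∧ ∀ R : ℝ, 0 < R →
    ∑' m : Fin d → ℤ, Set.indicator {m | japaneseBracket m ≤ R}
      (fun m => ENNReal.ofReal (japaneseBracket m ^ (-γ))) m ≤
    ENNReal.ofReal (C * R ^ ((d : ℝ) - γ)) := by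
  obtain ⟨C, hC, h⟩ := dyadic_bound d γ (1 / 2) (by norm_num)
    (Real.rpow_lt_one (by norm_num) (by norm_num) (by linarith))
  refine ⟨C, hC, fun R hR => h R hR _ fun m hm => ?_⟩
  have hp := jb_pos m
  obtain ⟨j, h1, h2⟩ := exists_nat_pow_near (x := R / japaneseBracket m) (y := 2)
    ((one_le_div hp).2 hm) (by norm_num)
  refine ⟨j, ?_⟩
  rw [le_div_iff₀ hp] at h1
  rw [div_lt_iff₀ hp, pow_succ] at h2
  have : (1 / 2 : ℝ) ^ j * R = R / 2 ^ j := by rw [one_div_pow]; ring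
  rw [this]
  have h2j : (0 : ℝ) < 2 ^ j := by positivity
  constructor
  · rw [div_div, div_le_iff₀ (by positivity)]; linarith
  · rw [← mul_div_assoc, le_div_iff₀ h2j]; linarith

lemma outer_bound (d : ℕ) (γ : ℝ) (hγ : d < γ) :
    ∃ C : ℝ, 0 < C ∧ ∀ R : ℝ, 0 < R →
    ∑' m : Fin d → ℤ, Set.indicator {m | R ≤ japaneseBracket m}
      (fun m => ENNReal.ofReal (japaneseBracket m ^ (-γ))) m ≤
    ENNReal.ofReal (C * R ^ ((d : ℝ) - γ)) := by
  obtain ⟨C, hC, h⟩ := dyadic_bound d γ 2 (by norm_num)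
    (Real.rpow_lt_one_of_one_lt_of_neg (by norm_num) (by linarith))
  refine ⟨C, hC, fun R hR => h R hR _ fun m hm => ?_⟩
  have hp := jb_pos m
  obtain ⟨j, h1, h2⟩ := exists_nat_pow_near (x := japaneseBracket m / R) (y := 2)
    ((one_le_div hR).2 hm) (by norm_num)
  refine ⟨j, ?_⟩
  rw [le_div_iff₀ hR] at h1
  rw [div_lt_iff₀ hR, pow_succ] at h2
  have : (0 : ℝ) < 2 ^ j * R := by positivity
  constructor <;> linarith

lemma mid_bound (d : ℕ) (β : ℝ) (hβ : β ≠ d) :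
    ∃ C : ℝ, 0 < C ∧ ∀ N : ℝ, 1 ≤ N →
    ∑' m : Fin d → ℤ, Set.indicator {m | japaneseBracket m ≤ 2 * N}
      (fun m => ENNReal.ofReal (japaneseBracket m ^ (-β))) m ≤
    ENNReal.ofReal (C * N ^ (max ((d : ℝ) - β) 0)) := by
  rcases lt_or_gt_of_ne hβ with hb | hb
  · obtain ⟨C, hC, h⟩ := inner_bound d β hb
    refine ⟨C * 2 ^ ((d : ℝ) - β), by positivity, fun N hN => ?_⟩
    refine (h (2 * N) (by linarith)).trans (le_of_eq ?_)
    rw [max_eq_left (by linarith), Real.mul_rpow (by norm_num) (by linarith)]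
    congr 1; ring
  · obtain ⟨C, hC, h⟩ := outer_bound d β hb
    refine ⟨C, hC, fun N hN => ?_⟩
    have := h 1 one_pos
    rw [Real.one_rpow] at this
    rw [max_eq_right (by linarith), Real.rpow_zero]
    refine le_trans (ENNReal.tsum_le_tsum fun m => ?_) this
    refine Set.indicator_le_indicator_of_subset (fun m _ => jb_one_le m) (fun _ => bot_le) m

lemma pointwise_bound (α β A B N : ℝ) (hA : 1 ≤ A) (hB : 1 ≤ B)
    (hN : 1 ≤ N) (h1 : N ≤ A + B) (h2 : A ≤ N + B) (h3 : B ≤ N + A) :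
    (A ≤ N / 2 ∧ A ^ (-α) * B ^ (-β) ≤ 4 ^ |(-β)| * N ^ (-β) * A ^ (-α)) ∨
    (B ≤ 2 * N ∧ A ^ (-α) * B ^ (-β) ≤ 4 ^ |(-α)| * N ^ (-α) * B ^ (-β)) ∨
    (2 * N ≤ B ∧ A ^ (-α) * B ^ (-β) ≤ 4 ^ |(-α)| * B ^ (-(α + β))) := by
  have hA' : 0 < A := by linarith
  have hB' : 0 < B := by linarith
  by_cases c1 : A ≤ N / 2
  · left
    refine ⟨c1, ?_⟩
    rw [mul_comm]
    gcongr
    exact rpow_comp _ (by linarith) (by linarith) (by linarith)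
  push Not at c1
  right
  by_cases c2 : B ≤ 2 * N
  · left
    refine ⟨c2, ?_⟩
    gcongr
    exact rpow_comp _ (by linarith) (by linarith) (by linarith)
  push Not at c2
  right
  refine ⟨c2.le, ?_⟩
  rw [neg_add, Real.rpow_add hB', ← mul_assoc]
  gcongr
  exact rpow_comp _ hB' (by linarith) (by linarith)

/-- Discrete convolution estimate (Lemma 2.3 of the paper), case `β ≠ d`:
if `α + β > d`, `α < d` and `β ≠ d`, then with `λ = max (d - β) 0` one has
`∑_{n₁ ∈ ℤ^d} ⟨n₁⟩^{-α} ⟨n - n₁⟩^{-β} ≲ ⟨n⟩^{-α+λ}`. -/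
theorem discrete_convolution_estimate (d : ℕ) (hd : 1 ≤ d) (α β : ℝ)
    (hsum : (d : ℝ) < α + β) (hα : α < d) (hβ : β ≠ (d : ℝ)) :
    ∃ C : ℝ, 0 < C ∧ ∀ n : Fin d → ℤ,
      Summable (fun n₁ : Fin d → ℤ =>
        japaneseBracket n₁ ^ (-α) * japaneseBracket (n - n₁) ^ (-β)) ∧
      ∑' n₁ : Fin d → ℤ, japaneseBracket n₁ ^ (-α) * japaneseBracket (n - n₁) ^ (-β)
        ≤ C * japaneseBracket n ^ (-α + max ((d : ℝ) - β) 0) := by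
  have hbr : ∃ C : ℝ, 0 < C ∧ ∀ n : Fin d → ℤ,
      ∑' m : Fin d → ℤ, ENNReal.ofReal
        (japaneseBracket m ^ (-α) * japaneseBracket (n - m) ^ (-β)) ≤
      ENNReal.ofReal (C * japaneseBracket n ^ (-α + max ((d : ℝ) - β) 0)) := by
    obtain ⟨C1, hC1, H1⟩ := inner_bound d α hα
    obtain ⟨C2, hC2, H2⟩ := mid_bound d β hβ
    obtain ⟨C3, hC3, H3⟩ := outer_bound d (α + β) hsum
    refine ⟨4 ^ |(-β)| * (C1 * (1 / 2) ^ ((d : ℝ) - α)) + 4 ^ |(-α)| * C2 +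
      4 ^ |(-α)| * (C3 * 2 ^ ((d : ℝ) - (α + β))), by positivity, fun n => ?_⟩
    set N := japaneseBracket n with hNdef
    have hN : 1 ≤ N := jb_one_le n
    have hN0 : 0 < N := jb_pos n
    have hpt : ∀ m : Fin d → ℤ, ENNReal.ofReal
        (japaneseBracket m ^ (-α) * japaneseBracket (n - m) ^ (-β)) ≤
        ENNReal.ofReal (4 ^ |(-β)| * N ^ (-β)) *
          Set.indicator {m | japaneseBracket m ≤ N / 2}
            (fun m => ENNReal.ofReal (japaneseBracket m ^ (-α))) m +
        ENNReal.ofReal (4 ^ |(-α)| * N ^ (-α)) *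
          Set.indicator {m | japaneseBracket m ≤ 2 * N}
            (fun m => ENNReal.ofReal (japaneseBracket m ^ (-β))) (n - m) +
        ENNReal.ofReal (4 ^ |(-α)|) *
          Set.indicator {m | 2 * N ≤ japaneseBracket m}
            (fun m => ENNReal.ofReal (japaneseBracket m ^ (-(α + β)))) (n - m) := by
      intro m
      have t1 : N ≤ japaneseBracket m + japaneseBracket (n - m) := by
        have := jb_add m (n - m); rwa [add_sub_cancel] at this
      have t2 : japaneseBracket m ≤ N + japaneseBracket (n - m) := by
        have := jb_add n (-(n - m)); rw [jb_neg] at this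
        have e : n + -(n - m) = m := by abel
        rwa [e] at this
      have t3 : japaneseBracket (n - m) ≤ N + japaneseBracket m := by
        have := jb_add n (-m); rw [jb_neg] at this
        rwa [← sub_eq_add_neg] at this
      rcases pointwise_bound α β _ _ N (jb_one_le m) (jb_one_le (n - m)) hN t1 t2 t3 with
        ⟨c, h⟩ | ⟨c, h⟩ | ⟨c, h⟩
      · refine le_trans ?_ (le_trans le_self_add le_self_add)
        rw [Set.indicator_of_mem (by exact c), ← ENNReal.ofReal_mul (by positivity)]
        exact ENNReal.ofReal_le_ofReal h
      · refine le_trans ?_ (le_trans le_add_self le_self_add)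
        rw [Set.indicator_of_mem (by exact c), ← ENNReal.ofReal_mul (by positivity)]
        exact ENNReal.ofReal_le_ofReal h
      · refine le_trans ?_ le_add_self
        rw [Set.indicator_of_mem (by exact c), ← ENNReal.ofReal_mul (by positivity)]
        exact ENNReal.ofReal_le_ofReal h
    refine (ENNReal.tsum_le_tsum hpt).trans ?_
    rw [ENNReal.tsum_add, ENNReal.tsum_add, ENNReal.tsum_mul_left, ENNReal.tsum_mul_left,
      ENNReal.tsum_mul_left]
    have re : ∀ f : (Fin d → ℤ) → ℝ≥0∞, ∑' m, f (n - m) = ∑' m, f m := fun f =>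
      (Equiv.subLeft n).tsum_eq f
    rw [re, re]
    refine (add_le_add (add_le_add (mul_le_mul_right (H1 (N / 2) (by linarith)) _)
      (mul_le_mul_right (H2 N hN) _)) (mul_le_mul_right (H3 (2 * N) (by linarith)) _)).trans ?_
    rw [← ENNReal.ofReal_mul (by positivity), ← ENNReal.ofReal_mul (by positivity),
      ← ENNReal.ofReal_mul (by positivity), ← ENNReal.ofReal_add (by positivity) (by positivity),
      ← ENNReal.ofReal_add (by positivity) (by positivity)]
    apply ENNReal.ofReal_le_ofReal
    have e1 : N ^ (-β) * N ^ ((d : ℝ) - α) ≤ N ^ (-α + max ((d : ℝ) - β) 0) := by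
      rw [← Real.rpow_add hN0]
      apply Real.rpow_le_rpow_of_exponent_le hN
      linarith [le_max_left ((d : ℝ) - β) 0]
    have e2 : N ^ (-α) * N ^ (max ((d : ℝ) - β) 0) = N ^ (-α + max ((d : ℝ) - β) 0) := by
      rw [← Real.rpow_add hN0]
    have e3 : N ^ ((d : ℝ) - (α + β)) ≤ N ^ (-α + max ((d : ℝ) - β) 0) := by
      apply Real.rpow_le_rpow_of_exponent_le hN
      linarith [le_max_left ((d : ℝ) - β) 0]
    have e4 : (N / 2) ^ ((d : ℝ) - α) = (1 / 2) ^ ((d : ℝ) - α) * N ^ ((d : ℝ) - α) := by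
      rw [← Real.mul_rpow (by norm_num) hN0.le]; congr 1; ring
    have e5 : (2 * N) ^ ((d : ℝ) - (α + β)) =
        2 ^ ((d : ℝ) - (α + β)) * N ^ ((d : ℝ) - (α + β)) := by
      rw [← Real.mul_rpow (by norm_num) hN0.le]
    rw [e4, e5, add_mul, add_mul]
    refine add_le_add (add_le_add ?_ ?_) ?_
    · calc _ = 4 ^ |(-β)| * (C1 * (1 / 2) ^ ((d : ℝ) - α)) *
            (N ^ (-β) * N ^ ((d : ℝ) - α)) := by ring
        _ ≤ _ := by gcongr
    · rw [← e2]; apply le_of_eq; ring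
    · calc _ = 4 ^ |(-α)| * (C3 * 2 ^ ((d : ℝ) - (α + β))) * N ^ ((d : ℝ) - (α + β)) := by ring
        _ ≤ _ := by gcongr
  obtain ⟨C, hC, h⟩ := hbr
  refine ⟨C, hC, fun n => ?_⟩
  have hnn : ∀ m : Fin d → ℤ,
      0 ≤ japaneseBracket m ^ (-α) * japaneseBracket (n - m) ^ (-β) := fun m =>
    mul_nonneg (Real.rpow_nonneg (jb_nonneg _) _) (Real.rpow_nonneg (jb_nonneg _) _)
  have hs : Summable (fun m : Fin d → ℤ =>
      japaneseBracket m ^ (-α) * japaneseBracket (n - m) ^ (-β)) := by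
    have := ENNReal.summable_toReal (ne_top_of_le_ne_top ENNReal.ofReal_ne_top (h n))
    refine this.congr fun m => ?_
    rw [ENNReal.toReal_ofReal (hnn m)]
  refine ⟨hs, ?_⟩
  have h' := h n
  rw [← ENNReal.ofReal_tsum_of_nonneg hnn hs] at h'
  exact (ENNReal.ofReal_le_ofReal_iff
    (mul_nonneg hC.le (Real.rpow_nonneg (jb_nonneg _) _))).1 h'
end

section
/- Let X be a Polish space (a complete separable metric space with its Borel σ-algebra), and let (μₙ)ₙ and (ρₙ)ₙ be sequences of Borel probability measures on X converging weakly to probability measures μ and ρ, respectively. Suppose there exist functions δ, η : (0,∞) → (0,∞) with δ(ε) → 0 and η(ε) → 0 as ε → 0⁺, such that for every ε > 0 and every continuous function F : X → ℝ satisfying 0 < inf_X F and F(x) ≤ 1 for all x ∈ X, the following implication holds: if there exists n₀ (possibly depending on F) such that μₙ({x ∈ X : F(x) ≤ ε}) ≥ 1 − δ(ε) for all n ≥ n₀, then limsup_{n→∞} ∫_X F dρₙ ≤ η(ε). Then ρ is absolutely continuous with respect to μ. -/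
open MeasureTheory Filter Topology

/-- Lemma A.1 of the paper: a criterion for absolute continuity. Let `X` be a Polish
space, `μₙ → μ` and `ρₙ → ρ` weakly (i.e. integrals of every bounded continuous
function converge). Suppose there are `δ, η : (0,∞) → (0,∞)` with `δ(ε), η(ε) → 0` as
`ε → 0⁺` such that for every `ε > 0` and every continuous `F : X → ℝ` with
`0 < inf F` and `F ≤ 1`: if `μₙ({F ≤ ε}) ≥ 1 − δ(ε)` for all large `n` (depending on `F`),
then `limsup_n ∫ F dρₙ ≤ η(ε)`. Then `ρ ≪ μ`. -/
theorem absolute_continuity_criterion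
    {X : Type*} [MetricSpace X] [TopologicalSpace.SeparableSpace X] [CompleteSpace X]
    [MeasurableSpace X] [BorelSpace X]
    (μs ρs : ℕ → Measure X) (μ ρ : Measure X)
    (hμsP : ∀ n, IsProbabilityMeasure (μs n)) (hρsP : ∀ n, IsProbabilityMeasure (ρs n))
    (hμP : IsProbabilityMeasure μ) (hρP : IsProbabilityMeasure ρ)
    (hμweak : ∀ F : BoundedContinuousFunction X ℝ,
      Tendsto (fun n => ∫ x, F x ∂(μs n)) atTop (𝓝 (∫ x, F x ∂μ)))
    (hρweak : ∀ F : BoundedContinuousFunction X ℝ,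
      Tendsto (fun n => ∫ x, F x ∂(ρs n)) atTop (𝓝 (∫ x, F x ∂ρ)))
    (δ η : ℝ → ℝ)
    (hδpos : ∀ ε : ℝ, 0 < ε → 0 < δ ε) (hηpos : ∀ ε : ℝ, 0 < ε → 0 < η ε)
    (hδ0 : Tendsto δ (𝓝[>] (0 : ℝ)) (𝓝 0)) (hη0 : Tendsto η (𝓝[>] (0 : ℝ)) (𝓝 0))
    (hmain : ∀ ε : ℝ, 0 < ε → ∀ F : X → ℝ, Continuous F →
      (∃ c : ℝ, 0 < c ∧ ∀ x, c ≤ F x) → (∀ x, F x ≤ 1) →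
      (∃ n₀ : ℕ, ∀ n ≥ n₀, 1 - δ ε ≤ ((μs n) {x | F x ≤ ε}).toReal) →
      limsup (fun n => ∫ x, F x ∂(ρs n)) atTop ≤ η ε) :
    ρ ≪ μ := by
  have key : ∀ K : Set X, IsClosed K → μ K = 0 → ∀ ε : ℝ, 0 < ε → ε ≤ 1 →
      ρ.real K ≤ η ε := by
    intro K hK hμK ε hε hε1
    have ht := HasOuterApproxClosed.tendsto_lintegral_apprSeq hK μ
    rw [hμK] at ht
    have hpos : 0 < ε * δ ε := mul_pos hε (hδpos ε hε)
    obtain ⟨m, hm⟩ := (ht.eventually (gt_mem_nhds (ENNReal.ofReal_pos.2 hpos))).exists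
    set f : X → ℝ := fun x => (hK.apprSeq m x : ℝ) with hf
    have hfc : Continuous f := NNReal.continuous_coe.comp (hK.apprSeq m).continuous
    have hf0 : ∀ x, 0 ≤ f x := fun x => NNReal.coe_nonneg _
    have hf1 : ∀ x, f x ≤ 1 := fun x => by
      exact_mod_cast HasOuterApproxClosed.apprSeq_apply_le_one hK m x
    have hfb : ∀ x, ‖f x‖ ≤ 1 := fun x => by
      rw [Real.norm_of_nonneg (hf0 x)]; exact hf1 x
    have hfint : ∫ x, f x ∂μ < ε * δ ε := by
      rw [integral_eq_lintegral_of_nonneg_ae (Eventually.of_forall hf0)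
        hfc.aestronglyMeasurable]
      refine (ENNReal.lt_ofReal_iff_toReal_lt (ne_top_of_lt hm)).1 ?_ |>.trans_eq' ?_
      · exact hm
      · simp [hf]
    have hfw := hμweak (BoundedContinuousFunction.ofNormedAddCommGroup f hfc 1 hfb)
    simp only [BoundedContinuousFunction.coe_ofNormedAddCommGroup] at hfw
    have hev := hfw.eventually (gt_mem_nhds hfint)
    set F : X → ℝ := fun x => max ε (f x) with hF
    have hFc : Continuous F := continuous_const.max hfc
    have hF1 : ∀ x, F x ≤ 1 := fun x => max_le hε1 (hf1 x)
    have hF0 : ∀ x, 0 ≤ F x := fun x => hε.le.trans (le_max_left _ _)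
    have hFb : ∀ x, ‖F x‖ ≤ 1 := fun x => by
      rw [Real.norm_of_nonneg (hF0 x)]; exact hF1 x
    have hFw := hρweak (BoundedContinuousFunction.ofNormedAddCommGroup F hFc 1 hFb)
    simp only [BoundedContinuousFunction.coe_ofNormedAddCommGroup] at hFw
    have hlim := hmain ε hε F hFc ⟨ε, hε, fun x => le_max_left _ _⟩ hF1 (by
      obtain ⟨n₀, hn₀⟩ := eventually_atTop.1 hev
      refine ⟨n₀, fun n hn => ?_⟩
      have h1 := hn₀ n hn
      have : IsProbabilityMeasure (μs n) := hμsP n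
      have hfi : Integrable f (μs n) :=
        Integrable.of_bound hfc.aestronglyMeasurable 1 (Eventually.of_forall hfb)
      have h2 := mul_meas_ge_le_integral_of_nonneg (μ := μs n)
        (Eventually.of_forall hf0) hfi ε
      have h3 : (μs n).real {x | ε ≤ f x} < δ ε :=
        lt_of_mul_lt_mul_left (h2.trans_lt h1) hε.le
      have h4 : {x | F x ≤ ε}ᶜ ⊆ {x | ε ≤ f x} := by
        intro x hx
        simp only [hF, Set.mem_compl_iff, Set.mem_ofPred_eq, max_le_iff, le_refl, true_and,
          not_le] at hx ⊢
        exact hx.le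
      have hms : MeasurableSet {x | F x ≤ ε} :=
        (isClosed_le hFc continuous_const).measurableSet
      have h5 := measureReal_mono (μ := μs n) h4
      rw [probReal_compl_eq_one_sub hms] at h5
      change 1 - δ ε ≤ (μs n).real {x | F x ≤ ε}
      linarith)
    rw [hFw.limsup_eq] at hlim
    refine le_trans ?_ hlim
    have hFi : Integrable F ρ :=
      Integrable.of_bound hFc.aestronglyMeasurable 1 (Eventually.of_forall hFb)
    have h6 := mul_meas_ge_le_integral_of_nonneg (μ := ρ) (Eventually.of_forall hF0) hFi 1
    rw [one_mul] at h6
    refine le_trans (measureReal_mono ?_) h6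
    intro x hx
    change 1 ≤ max ε (f x)
    refine le_trans ?_ (le_max_right ε (f x))
    simp [hf, HasOuterApproxClosed.apprSeq_apply_eq_one hK m hx]
  have key2 : ∀ K : Set X, IsClosed K → μ K = 0 → ρ K = 0 := by
    intro K hK hμK
    have h1 : ρ.real K ≤ 0 := by
      refine ge_of_tendsto hη0 ?_
      filter_upwards [Ioc_mem_nhdsGT (zero_lt_one (α := ℝ))] with ε hε
      exact key K hK hμK ε hε.1 hε.2
    exact (measureReal_eq_zero_iff).1 (le_antisymm h1 measureReal_nonneg)
  refine Measure.AbsolutelyContinuous.mk fun s hs hμs => ?_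
  by_contra hne
  obtain ⟨K, hKs, hK, hlt⟩ := hs.exists_lt_isClosed_of_ne_top (μ := ρ)
    (measure_ne_top ρ s) (pos_iff_ne_zero.2 hne)
  exact hlt.ne' (key2 K hK (measure_mono_null hKs hμs))
end
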